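/- Let Γ ↷ (X,μ) be an ergodic probability-measure-preserving action of a countable group Γ. Then there exists a compact metric space (K, d_K) with a Borel probability measure κ and a continuous action Γ ↷ K such that (a) Γ ↷ (X,μ) is measurably conjugate to Γ ↷ (K,κ), and (b) for every ε > 0 and all x, y ∈ K, 1/3 ≤ κ(B(x,ε))/κ(B(y,ε)) ≤ 3, where B(x,ε) = {z ∈ K : d_K(x,z) ≤ ε}. -/

import Mathlib

/-- A topological model for a pmp action of `Γ` on `(X,μ)` via `a`: a compact metric
space `K` with a Borel probability measure `κ` and a continuous `Γ`-action `c`,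
measurably conjugate to the given action, and such that measures of closed balls
of equal radii are comparable within a factor of `3`. -/
structure TopModel (Γ : Type*) [Group Γ] (X : Type*) [MeasurableSpace X]
    (μ : MeasureTheory.Measure X) (a : Γ → X → X) where
  K : Type
  [metricK : MetricSpace K]
  [measK : MeasurableSpace K]
  borelK : BorelSpace K
  compactK : CompactSpace K
  κ : MeasureTheory.Measure K
  probK : MeasureTheory.IsProbabilityMeasure κ
  c : Γ → K → K
  c_cont : ∀ γ : Γ, Continuous (c γ)
  c_one : c 1 = id
  c_mul : ∀ γ γ' : Γ, c (γ * γ') = c γ ∘ c γ'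
  c_pres : ∀ γ : Γ, κ.map (c γ) = κ
  Φ : X → K
  Ψ : K → X
  meas_Φ : Measurable Φ
  meas_Ψ : Measurable Ψ
  map_Φ : μ.map Φ = κ
  map_Ψ : κ.map Ψ = μ
  inv_ΨΦ : ∀ᵐ x ∂μ, Ψ (Φ x) = x
  inv_ΦΨ : ∀ᵐ k ∂κ, Φ (Ψ k) = k
  equivariant : ∀ γ : Γ, ∀ᵐ x ∂μ, Φ (a γ x) = c γ (Φ x)
  ball_ratio : ∀ ε : ℝ, 0 < ε → ∀ x y : K,
    κ (Metric.closedBall x ε) ≤ 3 * κ (Metric.closedBall y ε)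

section

open MeasureTheory Topology

/-- A finite family of small weights with total weight at least `δ` can be grouped into classes of
weight between `δ` and `3 * δ`. -/
theorem Finset.exists_grouping {ι : Type*} {δ : ℝ} (hδ : 0 < δ) (w : ι → ℝ) (s : Finset ι)
    (hw : ∀ i ∈ s, w i ≤ δ) (hs : δ ≤ ∑ i ∈ s, w i) :
    ∃ g : ι → ℕ, ∀ i ∈ s, (∑ j ∈ s with g j = g i, w j) ∈ Set.Icc δ (3 * δ) := by
  classical
  induction s using Finset.strongInduction with
  | H s ih =>
    by_cases h3 : ∑ i ∈ s, w i ≤ 3 * δ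
    · exact ⟨fun _ => 0, fun i _ => by simpa using ⟨hs, h3⟩⟩
    push Not at h3
    obtain ⟨t, ht, htmin⟩ := exists_minimal_le_of_wellFoundedLT
      (fun t : Finset ι => t ⊆ s ∧ δ ≤ ∑ i ∈ t, w i) s ⟨subset_rfl, hs⟩
    have hts := htmin.prop.1
    have htδ := htmin.prop.2
    have htne : t.Nonempty := by
      rw [Finset.nonempty_iff_ne_empty]
      rintro rfl
      simp at htδ
      linarith
    have ht2 : ∑ i ∈ t, w i ≤ 2 * δ := by
      obtain ⟨i, hi⟩ := htne
      have hlt : ∑ j ∈ t.erase i, w j < δ := by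
        by_contra! hge
        have := htmin.le_of_le ⟨(Finset.erase_subset i t).trans hts, hge⟩ (Finset.erase_subset i t)
        exact Finset.notMem_erase i t (this hi)
      have := Finset.add_sum_erase t w hi
      have := hw i (hts hi)
      linarith
    have hsum := Finset.sum_sdiff (f := w) hts
    obtain ⟨g, hg⟩ := ih (s \ t) (Finset.sdiff_ssubset hts htne)
      (fun i hi => hw i (Finset.sdiff_subset hi)) (by linarith)
    refine ⟨fun i => if i ∈ t then 0 else g i + 1, fun i hi => ?_⟩
    by_cases hit : i ∈ t
    · have : s.filter (fun j => (if j ∈ t then 0 else g j + 1) = if i ∈ t then 0 else g i + 1)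
          = t := by
        ext j
        have := @hts j
        simp only [Finset.mem_filter, hit]
        grind
      rw [this]
      exact ⟨htδ, by linarith⟩
    · have : s.filter (fun j => (if j ∈ t then 0 else g j + 1) = if i ∈ t then 0 else g i + 1)
          = (s \ t).filter (fun j => g j = g i) := by
        ext j
        simp only [Finset.mem_filter, hit, Finset.mem_sdiff]
        grind
      rw [this]
      exact hg i (by simp [hi, hit])

section Partitions

variable {K : Type*} [TopologicalSpace K] [CompactSpace K] [MeasurableSpace K]

/-- Without atoms, a profinite space has clopen partitions into pieces of small measure. -/
theorem exists_isLocallyConstant_measure_le [BorelSpace K] [TopologicalSpace.MetrizableSpace K]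
    [TotallyDisconnectedSpace K] (κ : Measure K) [IsFiniteMeasure κ] [NullSingletonClass κ]
    {δ : ENNReal} (hδ : 0 < δ) :
    ∃ r : K → ℕ, IsLocallyConstant r ∧ ∀ x, κ (r ⁻¹' {r x}) ≤ δ := by
  classical
  suffices ∃ r : K → ℕ, IsLocallyConstant r ∧ ∀ x ∈ Set.univ, κ (r ⁻¹' {r x}) ≤ δ by simpa using this
  refine isCompact_univ.induction_on
    (p := fun s => ∃ r : K → ℕ, IsLocallyConstant r ∧ ∀ x ∈ s, κ (r ⁻¹' {r x}) ≤ δ)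
    ⟨fun _ => 0, .const _, by simp⟩ ?_ ?_ ?_
  · rintro s t hst ⟨r, hr, h⟩
    exact ⟨r, hr, fun x hx => h x (hst hx)⟩
  · rintro s t ⟨r, hr, h⟩ ⟨r', hr', h'⟩
    refine ⟨fun x => Nat.pair (r x) (r' x), hr.comp₂ hr' Nat.pair, fun x hx => ?_⟩
    rcases hx with hx | hx
    · refine (measure_mono fun y hy => ?_).trans (h x hx)
      simp_all [Nat.pair_eq_pair]
    · refine (measure_mono fun y hy => ?_).trans (h' x hx)
      simp_all [Nat.pair_eq_pair]
  · intro x _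
    obtain ⟨U, hU, hUo, hUδ⟩ := Set.exists_isOpen_lt_of_lt {x} δ (μ := κ) (by simpa using hδ)
    obtain ⟨V, hV, hxV, hVU⟩ := compact_exists_isClopen_in_isOpen hUo (hU rfl)
    refine ⟨V, mem_nhdsWithin_of_mem_nhds (hV.isOpen.mem_nhds hxV), fun y => if y ∈ V then 0 else 1,
      ?_, fun y hy => ?_⟩
    · convert (LocallyConstant.ofIsClopen hV).isLocallyConstant.comp Fin.val using 2 with y
      simp only [LocallyConstant.ofIsClopen, Function.comp_apply]
      split_ifs <;> rfl
    refine (measure_mono fun z hz => hVU ?_).trans hUδ.le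
    simp [hy] at hz
    exact hz

/-- Any clopen partition of an atomless profinite probability space with full support can be refined
to a clopen partition with cells of comparable measure. -/
theorem exists_isLocallyConstant_refinement [BorelSpace K] [TopologicalSpace.MetrizableSpace K]
    [TotallyDisconnectedSpace K] (κ : Measure K) [IsFiniteMeasure κ] [NullSingletonClass κ]
    [κ.IsOpenPosMeasure] (q : K → ℕ) (hq : IsLocallyConstant q) :
    ∃ p : K → ℕ, IsLocallyConstant p ∧ (∀ x y, p x = p y → q x = q y) ∧
      ∀ x y, κ (p ⁻¹' {p x}) ≤ 3 * κ (p ⁻¹' {p y}) := by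
  classical
  have pos (x : K) : 0 < κ.real (q ⁻¹' {q x}) :=
    ENNReal.toReal_pos ((hq.isOpen_fiber (q x)).measure_pos κ ⟨x, rfl⟩).ne' (by finiteness)
  obtain ⟨δ, hδ, hδq⟩ : ∃ δ : ℝ, 0 < δ ∧ ∀ x, δ ≤ κ.real (q ⁻¹' {q x}) := by
    rcases isEmpty_or_nonempty K with hK | hK
    · exact ⟨1, one_pos, fun x => hK.elim x⟩
    obtain ⟨_, ⟨x, rfl⟩, hx⟩ := Set.exists_min_image (Set.range q) (fun i => κ.real (q ⁻¹' {i}))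
      hq.range_finite (Set.range_nonempty q)
    exact ⟨_, pos x, fun y => hx _ ⟨y, rfl⟩⟩
  obtain ⟨r, hr, hrδ⟩ := exists_isLocallyConstant_measure_le κ (ENNReal.ofReal_pos.2 hδ)
  set u : K → ℕ := fun x => Nat.pair (q x) (r x) with hu_def
  have hu : IsLocallyConstant u := hq.comp₂ hr Nat.pair
  have hum (i : ℕ) : MeasurableSet (u ⁻¹' {i}) := (hu.isOpen_fiber i).measurableSet
  have huq (x : K) : (u x).unpair.1 = q x := by simp [hu_def]
  let R : Finset ℕ := hu.range_finite.toFinset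
  have hR (x : K) : u x ∈ R := by simp [R]
  let s (j : ℕ) : Finset ℕ := R.filter fun i => i.unpair.1 = j
  have hus (x : K) (j : ℕ) : u x ∈ s j ↔ q x = j := by simp [s, hR, huq]
  let w (i : ℕ) : ℝ := κ.real (u ⁻¹' {i})
  have hw (i : ℕ) (hi : i ∈ R) : w i ≤ δ := by
    obtain ⟨x, rfl⟩ : i ∈ Set.range u := by simpa [R] using hi
    refine ENNReal.toReal_le_of_le_ofReal hδ.le ((measure_mono fun y hy => ?_).trans (hrδ x))
    simp_all [Nat.pair_eq_pair]
  have key (x : K) : ∃ g : ℕ → ℕ, ∀ i ∈ s (q x),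
      (∑ j ∈ s (q x) with g j = g i, w j) ∈ Set.Icc δ (3 * δ) := by
    refine Finset.exists_grouping hδ w _ (fun i hi => hw i (Finset.filter_subset _ _ hi)) ?_
    rw [sum_measureReal_preimage_singleton _ (fun i _ => hum i)]
    convert hδq x using 2
    ext y
    simp [hus]
  have key' (j : ℕ) : ∃ g : ℕ → ℕ, ∀ i ∈ s j, j ∈ Set.range q →
      (∑ k ∈ s j with g k = g i, w k) ∈ Set.Icc δ (3 * δ) := by
    by_cases hj : j ∈ Set.range q
    · obtain ⟨x, rfl⟩ := hj
      obtain ⟨g, hg⟩ := key x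
      exact ⟨g, fun i hi _ => hg i hi⟩
    · exact ⟨id, fun _ _ h => (hj h).elim⟩
  choose g hg using key'
  let p (x : K) : ℕ := Nat.pair (q x) (g (q x) (u x))
  have hp (x : K) : κ.real (p ⁻¹' {p x}) ∈ Set.Icc δ (3 * δ) := by
    have := hg (q x) (u x) ((hus _ _).2 rfl) ⟨x, rfl⟩
    rw [sum_measureReal_preimage_singleton _ (fun i _ => hum i)] at this
    convert this using 2
    ext y
    simp only [p, Set.mem_preimage, Set.mem_singleton_iff, Nat.pair_eq_pair, Finset.coe_filter,
      Set.mem_ofPred_eq, hus]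
    grind
  refine ⟨p, ?_, fun x y h => (Nat.pair_eq_pair.1 h).1, fun x y => ?_⟩
  · exact hq.comp₂ hu fun i j => Nat.pair i (g i j)
  · have h : κ.real (p ⁻¹' {p x}) ≤ 3 * κ.real (p ⁻¹' {p y}) := by
      linarith [(hp x).2, (hp y).1]
    rw [← ENNReal.toReal_le_toReal (by finiteness) (by finiteness)]
    simpa [measureReal_def] using h

/-- A profinite space with sufficiently many clopen partitions into cells of comparable measure has
a compatible metric whose balls have comparable measure. -/
theorem exists_metricSpace_closedBall_le (κ : Measure K) (f : ℕ → K → ℕ)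
    (hf : ∀ n, IsLocallyConstant (f n)) (hf_inj : ∀ x y, (∀ n, f n x = f n y) → x = y)
    (href : ∀ q : K → ℕ, IsLocallyConstant q →
      ∃ p : K → ℕ, IsLocallyConstant p ∧ (∀ x y, p x = p y → q x = q y) ∧
        ∀ x y, κ (p ⁻¹' {p x}) ≤ 3 * κ (p ⁻¹' {p y})) :
    ∃ m : MetricSpace K, m.toUniformSpace.toTopologicalSpace = ‹TopologicalSpace K› ∧
      ∀ ε : ℝ, 0 < ε → ∀ x y : K,
        κ (Metric.closedBall x ε) ≤ 3 * κ (Metric.closedBall y ε) := by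
  choose! ref ref_lc ref_le ref_comp using href
  let p : ℕ → K → ℕ := Nat.rec (ref (f 0)) fun n q => ref fun x => Nat.pair (q x) (f (n + 1) x)
  have hp_lc (n : ℕ) : IsLocallyConstant (p n) := by
    induction n with
    | zero => exact ref_lc _ (hf 0)
    | succ n ih => exact ref_lc _ (ih.comp₂ (hf (n + 1)) Nat.pair)
  have hq_lc (n : ℕ) : IsLocallyConstant fun x => Nat.pair (p n x) (f (n + 1) x) :=
    (hp_lc n).comp₂ (hf (n + 1)) Nat.pair
  have hp_comp (n : ℕ) (x y : K) : κ (p n ⁻¹' {p n x}) ≤ 3 * κ (p n ⁻¹' {p n y}) := by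
    cases n with
    | zero => exact ref_comp _ (hf 0) x y
    | succ n => exact ref_comp _ (hq_lc n) x y
  have hp_f (n : ℕ) (x y : K) (h : p n x = p n y) : f n x = f n y := by
    cases n with
    | zero => exact ref_le _ (hf 0) x y h
    | succ n => exact (Nat.pair_eq_pair.1 (ref_le _ (hq_lc n) x y h)).2
  have hp_anti (x y : K) : Antitone fun n => p n x = p n y :=
    antitone_nat_of_succ_le fun n h => (Nat.pair_eq_pair.1 (ref_le _ (hq_lc n) x y h)).1
  let P : K → ℕ → ℕ := fun x n => p n x
  have hP_inj : Function.Injective P := fun x y h =>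
    hf_inj x y fun n => hp_f n x y (congrFun h n)
  have hP : IsEmbedding P :=
    (Continuous.isClosedEmbedding (continuous_pi fun n => (hp_lc n).continuous) hP_inj).isEmbedding
  let mN : MetricSpace (ℕ → ℕ) := PiNat.metricSpace
  refine ⟨hP.comapMetricSpace P, rfl, fun ε hε => ?_⟩
  let := hP.comapMetricSpace P
  obtain ⟨n, hn⟩ : ∃ n : ℕ, ∀ x y, y ∈ Metric.closedBall x ε ↔ P y ∈ PiNat.cylinder (P x) n := by
    have hex : ∃ n : ℕ, (1 / 2 : ℝ) ^ n ≤ ε :=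
      (exists_pow_lt_of_lt_one hε (by norm_num)).imp fun _ => le_of_lt
    classical
    refine ⟨Nat.find hex, fun x y => ⟨fun h => ?_, fun h => ?_⟩⟩
    · have hd : dist (P y) (P x) ≤ ε := h
      rcases eq_or_ne (P y) (P x) with he | hne
      · simp [he]
      rw [PiNat.mem_cylinder_iff_le_firstDiff hne]
      rw [show dist (P y) (P x) = (1 / 2) ^ PiNat.firstDiff (P y) (P x) from
        PiNat.dist_eq_of_ne hne] at hd
      exact Nat.find_min' hex hd
    · exact (PiNat.mem_cylinder_iff_dist_le.1 h).trans (Nat.find_spec hex)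
  intro x y
  cases n with
  | zero =>
    have h (x : K) : Metric.closedBall x ε = Set.univ := by
      ext z
      simp [hn]
    rw [h, h]
    exact le_mul_of_one_le_left zero_le (by norm_num)
  | succ n =>
    have h (x : K) : Metric.closedBall x ε = p n ⁻¹' {p n x} := by
      ext z
      rw [hn]
      exact ⟨fun h => h n n.lt_succ_self, fun h i hi => hp_anti z x (Nat.le_of_lt_succ hi) h⟩
    rw [h, h]
    exact hp_comp n x y

end Partitions

/-- In a pmp action, the mass of a point is constant along its orbit. -/
theorem measure_singleton_orbit {Γ X : Type*} [Group Γ] [MeasurableSpace X]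
    [MeasurableSingletonClass X] {μ : Measure X} (a : Γ → X → X) (ha_one : a 1 = id)
    (ha_mul : ∀ γ γ' : Γ, a (γ * γ') = a γ ∘ a γ')
    (ha_mp : ∀ γ : Γ, MeasurePreserving (a γ) μ μ) (γ : Γ) (x : X) :
    μ {a γ x} = μ {x} := by
  have hinj : Function.Injective (a γ) := by
    have h : Function.LeftInverse (a γ⁻¹) (a γ) := fun y => by
      rw [← Function.comp_apply (f := a γ⁻¹), ← ha_mul, inv_mul_cancel, ha_one, id]
    exact h.injective
  rw [← (ha_mp γ).measure_preimage (measurableSet_singleton _).nullMeasurableSet,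
    ← Set.image_singleton, hinj.preimage_image]

/-- In an ergodic pmp action of a countable group, the orbit of an atom is finite and conull. -/
theorem orbit_finite_of_measure_singleton_ne_zero {Γ X : Type*} [Group Γ] [Countable Γ]
    [MeasurableSpace X] [MeasurableSingletonClass X] (μ : Measure X) [IsFiniteMeasure μ]
    (a : Γ → X → X) (ha_one : a 1 = id) (ha_mul : ∀ γ γ' : Γ, a (γ * γ') = a γ ∘ a γ')
    (ha_mp : ∀ γ : Γ, MeasurePreserving (a γ) μ μ)
    (ha_erg : ∀ A : Set X, MeasurableSet A → (∀ γ : Γ, a γ ⁻¹' A = A) → μ A = 0 ∨ μ A = 1)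
    {x₀ : X} (hx₀ : μ {x₀} ≠ 0) :
    (Set.range fun γ => a γ x₀).Finite ∧ μ (Set.range fun γ => a γ x₀) = 1 := by
  constructor
  · by_contra hinf
    refine measure_ne_top μ _ (Set.Infinite.meas_eq_top (μ := μ) hinf ⟨_, hx₀, ?_⟩)
    rintro _ ⟨γ, rfl⟩
    exact (measure_singleton_orbit a ha_one ha_mul ha_mp γ x₀).ge
  · refine (ha_erg _ (Set.countable_range _).measurableSet fun γ => ?_).resolve_left fun h => ?_
    · ext x
      constructor
      · rintro ⟨δ, hδ⟩
        refine ⟨γ⁻¹ * δ, ?_⟩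
        simp only at hδ ⊢
        rw [ha_mul, Function.comp_apply, hδ, ← Function.comp_apply (f := a γ⁻¹), ← ha_mul,
          inv_mul_cancel, ha_one, id]
      · rintro ⟨δ, rfl⟩
        exact ⟨γ * δ, by simp [ha_mul]⟩
    · exact hx₀ (measure_mono_null (t := Set.range fun γ => a γ x₀)
        (Set.singleton_subset_iff.2 ⟨1, by simp [ha_one]⟩) h)

/-- A topological model from a compact space whose topology is induced by a metric with balls of
comparable measure. -/
theorem TopModel.nonempty_of_topologicalSpace {Γ X : Type*} [Group Γ] [MeasurableSpace X]
    {μ : Measure X} {a : Γ → X → X} {K : Type} [tK : TopologicalSpace K] [CompactSpace K]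
    [MeasurableSpace K] [BorelSpace K] [MeasurableEq K] (κ : Measure K) [IsProbabilityMeasure κ]
    (ha_pres : ∀ γ : Γ, MeasurePreserving (a γ) μ μ)
    (hmetric : ∃ m : MetricSpace K, m.toUniformSpace.toTopologicalSpace = tK ∧
      ∀ ε : ℝ, 0 < ε → ∀ x y : K, κ (Metric.closedBall x ε) ≤ 3 * κ (Metric.closedBall y ε))
    (c : Γ → K → K) (c_cont : ∀ γ, Continuous (c γ)) (c_one : c 1 = id)
    (c_mul : ∀ γ γ', c (γ * γ') = c γ ∘ c γ') (Φ : X → K) (Ψ : K → X)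
    (hΦ : MeasurePreserving Φ μ κ) (hΨ : Measurable Ψ) (inv : ∀ᵐ x ∂μ, Ψ (Φ x) = x)
    (equivariant : ∀ γ : Γ, ∀ᵐ x ∂μ, Φ (a γ x) = c γ (Φ x)) :
    Nonempty (TopModel Γ X μ a) := by
  obtain ⟨m, rfl, hm⟩ := hmetric
  refine ⟨{ K := K, borelK := ‹_›, compactK := ‹_›, κ := κ, probK := ‹_›, c := c, c_cont := c_cont,
            c_one := c_one, c_mul := c_mul, c_pres := fun γ => ?_, Φ := Φ, Ψ := Ψ,
            meas_Φ := hΦ.measurable, meas_Ψ := hΨ, map_Φ := hΦ.map_eq, map_Ψ := ?_,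
            inv_ΨΦ := inv, inv_ΦΨ := ?_, equivariant := equivariant, ball_ratio := hm }⟩
  · rw [← hΦ.map_eq, Measure.map_map (c_cont γ).measurable hΦ.measurable,
      ← Measure.map_congr (f := Φ ∘ a γ) (g := c γ ∘ Φ) (equivariant γ),
      ← Measure.map_map hΦ.measurable (ha_pres γ).measurable, (ha_pres γ).map_eq]
  · rw [← hΦ.map_eq, Measure.map_map hΨ hΦ.measurable, Measure.map_congr (f := Ψ ∘ Φ) (g := id) inv,
      Measure.map_id]
  · have hmeas : MeasurableSet {k | Φ (Ψ k) = k} :=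
      measurableSet_eq_fun (hΦ.measurable.comp hΨ) measurable_id
    rw [← hΦ.map_eq, ae_map_iff hΦ.measurable.aemeasurable hmeas]
    filter_upwards [inv] with x hx
    rw [hx]

end

open MeasureTheory in
theorem stmt11 {Γ X : Type*} [Group Γ] [Countable Γ]
    [MeasurableSpace X] [StandardBorelSpace X]
    (μ : Measure X) [IsProbabilityMeasure μ]
    (a : Γ → X → X) (ha_one : a 1 = id)
    (ha_mul : ∀ γ γ' : Γ, a (γ * γ') = a γ ∘ a γ')
    (ha_meas : ∀ γ : Γ, Measurable (a γ))
    (ha_pres : ∀ γ : Γ, μ.map (a γ) = μ)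
    (ha_erg : ∀ A : Set X, MeasurableSet A → (∀ γ : Γ, a γ ⁻¹' A = A) →
      μ A = 0 ∨ μ A = 1) :
    Nonempty (TopModel Γ X μ a) := by
  have ha_mp (γ : Γ) : MeasurePreserving (a γ) μ μ := ⟨ha_meas γ, ha_pres γ⟩
  have ha_mul' (γ γ' : Γ) (x : X) : a γ (a γ' x) = a (γ * γ') x := by rw [ha_mul]; rfl
  -- the symbolic coding of the action
  let e : Γ ≃ Shrink.{0} Γ := equivShrink.{0} Γ
  have : Countable (Shrink.{0} Γ) := e.symm.countable_iff.2 ‹_›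
  let φ : X → Shrink.{0} Γ → ℕ → Bool := fun x i => MeasurableSpace.mapNatBool X (a (e.symm i) x)
  have hφ_meas : Measurable φ := measurable_pi_lambda _ fun i =>
    (MeasurableSpace.measurable_mapNatBool X).comp (ha_meas _)
  have hφ_inj : Function.Injective φ := fun x y h => by
    have := MeasurableSpace.injective_mapNatBool X (congrFun h (e 1))
    simpa [ha_one] using this
  have hφ : MeasurableEmbedding φ := hφ_meas.measurableEmbedding hφ_inj
  let σ : Γ → (Shrink.{0} Γ → ℕ → Bool) → Shrink.{0} Γ → ℕ → Bool :=
    fun γ s i => s (e (e.symm i * γ))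
  have hσ_cont (γ : Γ) : Continuous (σ γ) := continuous_pi fun i => continuous_apply _
  have hσ (γ : Γ) (x : X) : φ (a γ x) = σ γ (φ x) := by
    ext i : 1
    simp [φ, σ, ha_mul']
  let κ₀ := μ.map φ
  have : IsProbabilityMeasure κ₀ := Measure.isProbabilityMeasure_map hφ_meas.aemeasurable
  have hσ_mp (γ : Γ) : MeasurePreserving (σ γ) κ₀ κ₀ := by
    refine ⟨(hσ_cont γ).measurable, ?_⟩
    rw [Measure.map_map (hσ_cont γ).measurable hφ_meas,
      show σ γ ∘ φ = φ ∘ a γ from funext fun x => (hσ γ x).symm,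
      ← Measure.map_map hφ_meas (ha_meas γ), ha_pres]
  -- the model is the support of the image measure
  have hmaps (γ : Γ) : Set.MapsTo (σ γ) κ₀.support κ₀.support := fun s hs => by
    rw [Measure.mem_support_iff_forall] at hs ⊢
    intro U hU
    obtain ⟨V, hVU, hV, hsV⟩ := mem_nhds_iff.1 hU
    have := hs _ ((hσ_cont γ).continuousAt.preimage_mem_nhds (hV.mem_nhds hsV))
    rw [(hσ_mp γ).measure_preimage hV.measurableSet.nullMeasurableSet] at this
    exact this.trans_le (measure_mono hVU)
  have hsupp : ∀ᵐ x ∂μ, φ x ∈ κ₀.support :=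
    ae_of_ae_map hφ_meas.aemeasurable Measure.support_mem_ae
  have : CompactSpace κ₀.support := isCompact_iff_compactSpace.1 Measure.isClosed_support.isCompact
  obtain ⟨k₀⟩ : Nonempty κ₀.support :=
    (Measure.nonempty_support (IsProbabilityMeasure.ne_zero κ₀)).to_subtype
  classical
  let Φ : X → κ₀.support := fun x => if h : φ x ∈ κ₀.support then ⟨φ x, h⟩ else k₀
  have hΦ_meas : Measurable Φ :=
    Measurable.dite (s := φ ⁻¹' κ₀.support) (f := fun x => (⟨φ x, x.2⟩ : κ₀.support))
      (g := fun _ => k₀)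
      (hφ_meas.comp measurable_subtype_coe).subtype_mk measurable_const
      (hφ_meas Measure.isClosed_support.measurableSet)
  have hΦ : ∀ᵐ x ∂μ, (Φ x : Shrink.{0} Γ → ℕ → Bool) = φ x := by
    filter_upwards [hsupp] with x hx
    simp [Φ, hx]
  let κ := μ.map Φ
  have : IsProbabilityMeasure κ := Measure.isProbabilityMeasure_map hΦ_meas.aemeasurable
  have hκ : κ.map Subtype.val = κ₀ := by
    rw [Measure.map_map measurable_subtype_coe hΦ_meas]
    exact Measure.map_congr hΦ
  have : κ.IsOpenPosMeasure := ⟨by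
    rintro U hU ⟨s, hs⟩
    obtain ⟨V, hV, rfl⟩ := isOpen_induced_iff.1 hU
    rw [← Measure.map_apply measurable_subtype_coe hV.measurableSet, hκ]
    exact ((Measure.mem_support_iff_forall _).1 s.2 V (hV.mem_nhds hs)).ne'⟩
  have hκ_sing (s : κ₀.support) : κ {s} = κ₀ {s.1} := by
    have : κ.map Subtype.val {s.1} = κ₀ {s.1} := by rw [hκ]
    rw [← this, Measure.map_apply measurable_subtype_coe (measurableSet_singleton _)]
    congr 1
    ext
    simp [Subtype.ext_iff]
  have hκ₀_sing (x : X) : κ₀ {φ x} = μ {x} := by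
    rw [hφ.map_apply, ← Set.image_singleton, hφ_inj.preimage_image]
  have : Nonempty X := nonempty_of_isProbabilityMeasure μ
  refine TopModel.nonempty_of_topologicalSpace κ ha_mp ?_ (fun γ => (hmaps γ).restrict)
    (fun γ => (hσ_cont γ).restrict (hmaps γ)) ?_ ?_ Φ (hφ.invFun ∘ Subtype.val)
    ⟨hΦ_meas, rfl⟩ (hφ.measurable_invFun.comp measurable_subtype_coe) ?_ ?_
  · obtain ⟨d, hd⟩ := exists_surjective_nat (Shrink.{0} Γ × ℕ)
    refine exists_metricSpace_closedBall_le κ (fun n s => Encodable.encode (s.1 (d n).1 (d n).2))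
      (fun n => ?_) (fun s t h => ?_) ?_
    · have : Continuous fun s : κ₀.support => s.1 (d n).1 (d n).2 :=
        (continuous_apply_apply (d n).1 (d n).2).comp continuous_subtype_val
      exact ((IsLocallyConstant.iff_continuous _).2 this).comp Encodable.encode
    · ext i j : 3
      obtain ⟨n, hn⟩ := hd (i, j)
      have := h n
      rw [hn] at this
      exact Encodable.encode_injective this
    by_cases hatom : ∀ x, μ {x} = 0
    · have : NullSingletonClass κ := ⟨fun s => by
        rw [hκ_sing, hφ.map_apply]
        rcases (Set.subsingleton_singleton.preimage hφ_inj).eq_empty_or_singleton with h | ⟨x, h⟩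
        · rw [h, measure_empty]
        · rw [h, hatom]⟩
      exact exists_isLocallyConstant_refinement κ
    · push Not at hatom
      obtain ⟨x₀, hx₀⟩ := hatom
      obtain ⟨hfin, hone⟩ := orbit_finite_of_measure_singleton_ne_zero μ a ha_one ha_mul ha_mp
        ha_erg hx₀
      have hsub : κ₀.support ⊆ φ '' Set.range fun γ => a γ x₀ := by
        refine Measure.support_subset_of_isClosed (hfin.image φ).isClosed ?_
        rw [mem_ae_map_iff hφ_meas.aemeasurable (hfin.image φ).measurableSet,
          hφ_inj.preimage_image, mem_ae_iff_prob_eq_one hfin.measurableSet]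
        exact hone
      have hK (s : κ₀.support) : κ {s} = μ {x₀} := by
        obtain ⟨_, ⟨γ, rfl⟩, h⟩ := hsub s.2
        rw [hκ_sing, ← h, hκ₀_sing, measure_singleton_orbit a ha_one ha_mul ha_mp]
      have : Finite κ₀.support := ((hfin.image φ).subset hsub).to_subtype
      obtain ⟨p, hp⟩ := Countable.exists_injective_nat κ₀.support
      refine fun q _ => ⟨p, .of_discrete p, fun x y h => congrArg q (hp h), fun x y => ?_⟩
      simp only [← Set.image_singleton, hp.preimage_image, hK]
      exact le_mul_of_one_le_left zero_le (by norm_num)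
  · ext s : 2
    ext i : 1
    simp [σ]
  · intro γ γ'
    ext s : 2
    ext i : 1
    simp [σ, mul_assoc]
  · filter_upwards [hΦ] with x hx
    simp [hx, hφ.leftInverse_invFun x]
  · intro γ
    filter_upwards [hΦ, (ha_mp γ).quasiMeasurePreserving.ae hΦ] with x hx hx'
    ext1
    simp [hx, hx', hσ]
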